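/- arXiv:2404.17775 — 11 statements merged into one kernel-verified Lean document; each statement's English description precedes it below -/
import Mathlib

section
/- For every integer k ≥ 3, one has 1 - exp(-k·r_core(k)·e^(-(k-1)/k)) ≤ e^(-1/k); equivalently, G(k, r_core(k), e^(-1/k)) ≤ 0, where G(k,r,Q) = 1 - exp(-k·r·Q^(k-1)) - Q. -/
/-- `r_core(k)`: the supremum of the densities `r ∈ [0,1]` for which
`Q > 1 - exp(-k·r·Q^(k-1))` holds for all `Q ∈ (0,1)`. -/
noncomputable def rCore (k : ℕ) : ℝ :=
  sSup {r : ℝ | r ∈ Set.Icc (0:ℝ) 1 ∧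
    ∀ Q ∈ Set.Ioo (0:ℝ) 1, Q > 1 - Real.exp (-((k : ℝ) * r * Q ^ (k - 1)))}

/-- `G(k,r,Q) = 1 - exp(-k·r·Q^(k-1)) - Q`. -/
noncomputable def G (k : ℕ) (r Q : ℝ) : ℝ :=
  1 - Real.exp (-((k : ℝ) * r * Q ^ (k - 1))) - Q

/-- For every integer `k ≥ 3`,
`1 - exp(-k·r_core(k)·e^(-(k-1)/k)) ≤ e^(-1/k)`; equivalently `G(k, r_core(k), e^(-1/k)) ≤ 0`. -/
theorem stmt_2 (k : ℕ) (hk : 3 ≤ k) :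
    1 - Real.exp (-((k : ℝ) * rCore k * Real.exp (-(((k : ℝ) - 1) / (k : ℝ)))))
        ≤ Real.exp (-1 / (k : ℝ)) ∧
    G k (rCore k) (Real.exp (-1 / (k : ℝ))) ≤ 0 := by
  have hk0 : (0:ℝ) < k := by
    have : 0 < k := by omega
    exact_mod_cast this
  have hpow : Real.exp (-1 / (k : ℝ)) ^ (k - 1) = Real.exp (-(((k : ℝ) - 1) / (k : ℝ))) := by
    rw [← Real.exp_nat_mul, Nat.cast_sub (by omega)]
    congr 1
    push_cast
    field_simp
  have hQ : Real.exp (-1 / (k : ℝ)) ∈ Set.Ioo (0:ℝ) 1 := by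
    refine ⟨Real.exp_pos _, ?_⟩
    rw [Real.exp_lt_one_iff]
    exact div_neg_of_neg_of_pos (by norm_num) hk0
  have hG : G k (rCore k) (Real.exp (-1 / (k : ℝ))) ≤ 0 := by
    have hclosed : IsClosed {r : ℝ | G k r (Real.exp (-1 / (k : ℝ))) ≤ 0} := by
      apply isClosed_le _ continuous_const
      unfold G
      fun_prop
    have hmem : rCore k ∈ closure {r : ℝ | r ∈ Set.Icc (0:ℝ) 1 ∧
        ∀ Q ∈ Set.Ioo (0:ℝ) 1, Q > 1 - Real.exp (-((k : ℝ) * r * Q ^ (k - 1)))} := by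
      unfold rCore
      apply csSup_mem_closure
      · refine ⟨0, ⟨le_refl _, zero_le_one⟩, ?_⟩
        intro Q hQ
        simpa using hQ.1
      · exact ⟨1, fun r hr => hr.1.2⟩
    refine closure_minimal ?_ hclosed hmem
    intro r hr
    have := hr.2 _ hQ
    simp only [Set.mem_setOf_eq, G]
    linarith
  refine ⟨?_, hG⟩
  unfold G at hG
  rw [hpow] at hG
  linarith
end

section
/- For every integer k ≥ 3 there exists a unique real number r_1 ∈ [r_core(k), 1) such that G(k, r_1, e^(-1/k)) = 0; moreover G(k, r, e^(-1/k)) < 0 for all r ∈ [r_core(k), r_1) and G(k, r, e^(-1/k)) > 0 for all r ∈ (r_1, 1]. -/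
theorem G_aux (k : ℕ) (hk : 3 ≤ k) : 0 < G k 1 (Real.exp (-1 / (k : ℝ))) := by
  have hk' : (3:ℝ) ≤ k := by exact_mod_cast hk
  have hk0 : (0:ℝ) < k := by linarith
  have h1 : Real.exp (-1 / (k : ℝ)) ^ (k - 1) = Real.exp (-1) * Real.exp (1 / (k:ℝ)) := by
    rw [← Real.exp_nat_mul, ← Real.exp_add, Nat.cast_sub (by omega)]
    congr 1
    field_simp
    push_cast
    ring
  have h2 : 1 / (k:ℝ) + 1 ≤ Real.exp (1 / (k:ℝ)) := Real.add_one_le_exp _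
  have h3 : ((k:ℝ) + 1) * Real.exp (-1) ≤ k * 1 * Real.exp (-1 / (k : ℝ)) ^ (k - 1) := by
    rw [h1]
    have h4 : ((k:ℝ) + 1) = k * (1 / (k:ℝ) + 1) := by field_simp; ring
    have h5 : (k:ℝ) + 1 ≤ k * Real.exp (1 / (k:ℝ)) := by
      rw [h4]; exact mul_le_mul_of_nonneg_left h2 hk0.le
    nlinarith [Real.exp_pos (-1)]
  have he : Real.exp 1 < 3 := by linarith [Real.exp_one_lt_d9]
  have hee : Real.exp (-1) * Real.exp 1 = 1 := by rw [← Real.exp_add]; simp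
  have h6 : (k:ℝ) + 1 < Real.exp (((k:ℝ) + 1) * Real.exp (-1)) := by
    have h7 : ((k:ℝ) + 1) * Real.exp (-1) - 1 ≠ 0 := by
      intro h
      have : ((k:ℝ) + 1) * (Real.exp (-1) * Real.exp 1) = Real.exp 1 := by
        rw [← mul_assoc, sub_eq_zero.mp h, one_mul]
      rw [hee] at this
      linarith
    have h8 := Real.add_one_lt_exp h7
    have h9 : Real.exp (((k:ℝ) + 1) * Real.exp (-1))
        = Real.exp (((k:ℝ) + 1) * Real.exp (-1) - 1) * Real.exp 1 := by
      rw [← Real.exp_add]; congr 1; ring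
    rw [h9]
    have h10 := mul_lt_mul_of_pos_right h8 (Real.exp_pos 1)
    have h11 : (((k:ℝ) + 1) * Real.exp (-1) - 1 + 1) * Real.exp 1 = k + 1 := by
      rw [sub_add_cancel, mul_assoc, hee, mul_one]
    linarith
  have h12 : (k:ℝ) + 1 < Real.exp (k * 1 * Real.exp (-1 / (k : ℝ)) ^ (k - 1)) :=
    h6.trans_le (Real.exp_le_exp.mpr h3)
  have h13 : Real.exp (-(k * 1 * Real.exp (-1 / (k : ℝ)) ^ (k - 1))) < ((k:ℝ) + 1)⁻¹ := by
    rw [Real.exp_neg]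
    exact inv_strictAnti₀ (by linarith) h12
  have h14 : Real.exp (-1 / (k : ℝ)) ≤ (1 / (k:ℝ) + 1)⁻¹ := by
    rw [neg_div, Real.exp_neg]
    exact inv_anti₀ (by positivity) h2
  have h15 : (1 / (k:ℝ) + 1)⁻¹ + ((k:ℝ) + 1)⁻¹ = 1 := by
    field_simp
    ring
  unfold G
  linarith

theorem G_mono (k : ℕ) (hk : 3 ≤ k) (Q : ℝ) (hQ : 0 < Q) : StrictMono (fun r => G k r Q) := by
  intro a b hab
  have hk0 : (0:ℝ) < k := by exact_mod_cast (by omega : 0 < k)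
  have : Real.exp (-((k : ℝ) * b * Q ^ (k - 1))) < Real.exp (-((k : ℝ) * a * Q ^ (k - 1))) := by
    apply Real.exp_lt_exp.mpr
    have : 0 < (k:ℝ) * Q ^ (k-1) := by positivity
    nlinarith
  simp only [G]
  linarith

/-- For every integer `k ≥ 3` there exists a unique `r₁ ∈ [r_core(k), 1)`
with `G(k, r₁, e^(-1/k)) = 0`; moreover `G(k, r, e^(-1/k)) < 0` for `r ∈ [r_core(k), r₁)`
and `G(k, r, e^(-1/k)) > 0` for `r ∈ (r₁, 1]`. -/
theorem stmt_3 (k : ℕ) (hk : 3 ≤ k) :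
    ∃ r₁ ∈ Set.Ico (rCore k) 1,
      G k r₁ (Real.exp (-1 / (k : ℝ))) = 0 ∧
      (∀ r' ∈ Set.Ico (rCore k) 1, G k r' (Real.exp (-1 / (k : ℝ))) = 0 → r' = r₁) ∧
      (∀ r ∈ Set.Ico (rCore k) r₁, G k r (Real.exp (-1 / (k : ℝ))) < 0) ∧
      (∀ r ∈ Set.Ioc r₁ 1, 0 < G k r (Real.exp (-1 / (k : ℝ)))) := by
  have hk0 : (0:ℝ) < k := by exact_mod_cast (by omega : 0 < k)
  have hQ := Real.exp_pos (-1 / (k : ℝ))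
  have hQ1 : Real.exp (-1 / (k : ℝ)) < 1 := by
    rw [Real.exp_lt_one_iff, neg_div]
    have : 0 < 1 / (k:ℝ) := by positivity
    linarith
  have hm := G_mono k hk _ hQ
  have h1 := G_aux k hk
  have h0 : G k 0 (Real.exp (-1 / (k : ℝ))) < 0 := by
    simp only [G, mul_zero, zero_mul, neg_zero, Real.exp_zero]
    linarith
  have hc : Continuous (fun r => G k r (Real.exp (-1 / (k : ℝ)))) := by
    unfold G; fun_prop
  obtain ⟨r, hr, hr0⟩ := intermediate_value_Icc (zero_le_one (α := ℝ)) hc.continuousOn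
    (show (0:ℝ) ∈ Set.Icc _ _ from ⟨h0.le, h1.le⟩)
  simp only at hr0
  refine ⟨r, ⟨?_, ?_⟩, hr0, ?_, ?_, ?_⟩
  · apply Real.sSup_le _ hr.1
    rintro x ⟨_, hx⟩
    have h2 := hx _ ⟨hQ, hQ1⟩
    apply le_of_lt
    apply hm.lt_iff_lt.mp
    simp only [hr0]
    unfold G
    linarith
  · apply hm.lt_iff_lt.mp
    simpa only [hr0] using h1
  · intro r' _ h
    exact hm.injective (by simp only [h, hr0])
  · intro r' h
    have := hm h.2
    simpa only [hr0] using this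
  · intro r' h
    have := hm h.1
    simpa only [hr0] using this
end

section
/- Let k ≥ 3 be an integer and r ∈ (0,1] a real number such that 1 - exp(-k·r·e^(-(k-1)/k)) > e^(-1/k). Then Q(k,r) > e^(-1/k). -/
/-- `Q(k,r)`: the largest solution in `[0,1]` of the fixed point equation
`Q = 1 - exp(-k·r·Q^(k-1))`. -/
noncomputable def Qfix (k : ℕ) (r : ℝ) : ℝ :=
  sSup {Q : ℝ | Q ∈ Set.Icc (0:ℝ) 1 ∧ Q = 1 - Real.exp (-((k : ℝ) * r * Q ^ (k - 1)))}

/-- If `k ≥ 3`, `r ∈ (0,1]` and `1 - exp(-k·r·e^(-(k-1)/k)) > e^(-1/k)`,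
then `Q(k,r) > e^(-1/k)`. -/
theorem stmt_4 (k : ℕ) (hk : 3 ≤ k) (r : ℝ) (hr : r ∈ Set.Ioc (0:ℝ) 1)
    (h : 1 - Real.exp (-((k : ℝ) * r * Real.exp (-(((k : ℝ) - 1) / (k : ℝ)))))
        > Real.exp (-1 / (k : ℝ))) :
    Qfix k r > Real.exp (-1 / (k : ℝ)) := by
  obtain ⟨hr0, hr1⟩ := hr
  have hk0 : (0:ℝ) < k := by
    have : 0 < k := by omega
    exact_mod_cast this
  set a : ℝ := Real.exp (-1 / (k : ℝ)) with ha
  have hpow : a ^ (k - 1) = Real.exp (-(((k : ℝ) - 1) / (k : ℝ))) := by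
    rw [ha, ← Real.exp_nat_mul, Nat.cast_sub (by omega)]
    congr 1
    push_cast
    ring
  have ha1 : a ≤ 1 := by
    rw [ha, Real.exp_le_one_iff]
    exact div_nonpos_of_nonpos_of_nonneg (by norm_num) hk0.le
  have ha0 : 0 < a := Real.exp_pos _
  rw [← hpow] at h
  have hc : ContinuousOn
      (fun Q : ℝ => 1 - Real.exp (-((k : ℝ) * r * Q ^ (k - 1))) - Q) (Set.Icc a 1) := by
    fun_prop
  have hmem : (0:ℝ) ∈ Set.Icc
      ((fun Q : ℝ => 1 - Real.exp (-((k : ℝ) * r * Q ^ (k - 1))) - Q) 1)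
      ((fun Q : ℝ => 1 - Real.exp (-((k : ℝ) * r * Q ^ (k - 1))) - Q) a) := by
    constructor
    · have := Real.exp_pos (-((k : ℝ) * r * 1 ^ (k - 1)))
      show 1 - Real.exp (-((k : ℝ) * r * 1 ^ (k - 1))) - 1 ≤ 0
      linarith
    · show 0 ≤ 1 - Real.exp (-((k : ℝ) * r * a ^ (k - 1))) - a
      linarith
  obtain ⟨q, ⟨hq1, hq2⟩, hq⟩ := intermediate_value_Icc' ha1 hc hmem
  have hq' : 1 - Real.exp (-((k : ℝ) * r * q ^ (k - 1))) - q = 0 := hq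
  have hne : a ≠ q := by
    intro e
    rw [← e] at hq'
    linarith
  have hlt : a < q := lt_of_le_of_ne hq1 hne
  refine lt_of_lt_of_le hlt (le_csSup ⟨1, fun x hx => hx.1.2⟩ ?_)
  exact ⟨⟨by linarith, hq2⟩, by linarith⟩
end

section
/- Let k ≥ 4 be an integer and r a real number with r_core(k) < r ≤ 1. Then Q(k,r) > e^(-1/k). -/
open Real Set in
theorem psi_mono (k : ℕ) (hk : 4 ≤ k) (L0 : ℝ) (hL0 : 0 < L0)
    (h0 : exp L0 - 1 ≤ ((k:ℝ) - 1) * L0) :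
    MonotoneOn (fun L : ℝ => ((k:ℝ) - 1) * log (1 - exp (-L)) - log L) (Ioc 0 L0) := by
  have hpos : ∀ L : ℝ, 0 < L → 0 < 1 - exp (-L) := by
    intro L hL
    have : exp (-L) < 1 := by rw [exp_lt_one_iff]; linarith
    linarith
  have hd : ∀ L : ℝ, 0 < L → HasDerivAt (fun L : ℝ => ((k:ℝ) - 1) * log (1 - exp (-L)) - log L)
      (((k:ℝ) - 1) * (exp (-L) / (1 - exp (-L))) - L⁻¹) L := by
    intro L hL
    have h1 : HasDerivAt (fun L : ℝ => 1 - exp (-L)) (exp (-L)) L := by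
      have := ((hasDerivAt_neg L).exp).const_sub 1
      simpa using this
    exact ((h1.log (hpos L hL).ne').const_mul _).sub (hasDerivAt_log hL.ne')
  apply monotoneOn_of_deriv_nonneg (convex_Ioc 0 L0)
  · intro L hL
    exact (hd L hL.1).continuousAt.continuousWithinAt
  · intro L hL
    rw [interior_Ioc] at hL
    exact (hd L hL.1).differentiableAt.differentiableWithinAt
  · intro L hL
    rw [interior_Ioc] at hL
    rw [(hd L hL.1).deriv]
    have hL1 := hL.1
    have hc := convexOn_exp.2 (mem_univ 0) (mem_univ L0) (show (0:ℝ) ≤ 1 - L / L0 by rw [sub_nonneg, div_le_one hL0]; exact hL.2.le)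
      (show (0:ℝ) ≤ L / L0 by positivity) (by ring)
    have e : L / L0 * L0 = L := by field_simp
    simp only [smul_eq_mul, mul_zero, zero_add, e, exp_zero, mul_one] at hc
    have h2 : L / L0 * (exp L0 - 1) ≤ L / L0 * (((k:ℝ) - 1) * L0) :=
      mul_le_mul_of_nonneg_left h0 (by positivity)
    have h3 : L / L0 * (((k:ℝ) - 1) * L0) = ((k:ℝ) - 1) * L := by field_simp
    have h4 : exp L - 1 ≤ ((k:ℝ) - 1) * L := by nlinarith
    have h5 : exp (-L) / (1 - exp (-L)) = (exp L - 1)⁻¹ := by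
      have := hpos L hL1
      have h6 : 0 < exp L - 1 := by
        have := add_one_lt_exp hL1.ne'
        linarith
      rw [div_eq_iff this.ne', eq_comm, inv_mul_eq_iff_eq_mul₀ h6.ne', sub_mul, ← exp_add]
      simp
    have h6 : 0 < exp L - 1 := by
      have := add_one_lt_exp hL1.ne'
      linarith
    rw [h5, sub_nonneg, inv_le_iff_one_le_mul₀ hL1, mul_comm ((k:ℝ)-1), mul_assoc,
      ← div_eq_inv_mul, le_div_iff₀ h6]
    linarith

open Real Set in
theorem L0_bound (k : ℕ) (hk : 4 ≤ k) :
    exp (-log (1 - exp (-1/(k:ℝ)))) - 1 ≤ ((k:ℝ) - 1) * (-log (1 - exp (-1/(k:ℝ)))) := by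
  have hk' : (4:ℝ) ≤ k := by exact_mod_cast hk
  have hk0 : (0:ℝ) < k := by linarith
  set Q := exp (-1/(k:ℝ)) with hQ
  have hQ1 : Q < 1 := by
    rw [hQ, exp_lt_one_iff]; exact div_neg_of_neg_of_pos (by norm_num) hk0
  have hp : 0 < 1 - Q := by linarith
  have hQp : 0 < Q := exp_pos _
  rw [exp_neg, exp_log hp]
  have h1 : Q * exp (1/(k:ℝ)) = 1 := by
    rw [hQ, ← exp_add]; simp [neg_div]
  have h2 : 1/(k:ℝ) + 1 ≤ exp (1/(k:ℝ)) := add_one_le_exp _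
  have h3 : Q * (1/(k:ℝ) + 1) ≤ 1 := by nlinarith
  have h3' : Q * (1 + k) ≤ k := by
    have : Q * (1 + k) = k * (Q * (1/(k:ℝ) + 1)) := by field_simp
    rw [this]; nlinarith
  have h4 : (1 - Q)⁻¹ - 1 ≤ k := by
    rw [sub_le_iff_le_add, inv_le_iff_one_le_mul₀ hp]; nlinarith
  have h5 : -1/(k:ℝ) + 1 ≤ Q := add_one_le_exp _
  have h6 : log k ≤ -log (1 - Q) := by
    rw [← log_inv]
    apply log_le_log hk0
    rw [le_inv_comm₀ hk0 hp]
    have : -1/(k:ℝ) = -(k:ℝ)⁻¹ := by ring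
    linarith
  have h7 : (4/3:ℝ) ≤ log k := by
    have : log 4 ≤ log (k:ℝ) := log_le_log (by norm_num) hk'
    have h8 : log 4 = 2 * log 2 := by
      rw [show (4:ℝ) = 2^2 by norm_num, log_pow]; norm_num
    have := log_two_gt_d9
    linarith
  nlinarith

open Real Set in
theorem cond_iff (k : ℕ) (hk : 4 ≤ k) (r : ℝ) (hr : 0 < r) (Q : ℝ) (h0 : 0 < Q) (h1 : Q < 1) :
    Q < 1 - exp (-((k:ℝ) * r * Q ^ (k-1))) ↔
    0 < log (k * r) + (((k:ℝ) - 1) * log (1 - exp (-(-log (1 - Q)))) - log (-log (1-Q))) := by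
  have hk' : (4:ℝ) ≤ k := by exact_mod_cast hk
  have hk0 : (0:ℝ) < k := by linarith
  have hp : 0 < 1 - Q := by linarith
  have hL : 0 < -log (1 - Q) := by
    have := log_neg hp (by linarith)
    linarith
  rw [neg_neg, exp_log hp, sub_sub_cancel]
  have hc : ((k:ℝ) - 1) = ((k-1:ℕ):ℝ) := by
    rw [Nat.cast_sub (by omega)]; simp
  have e : log (k*r) + (((k:ℝ) - 1) * log Q - log (-log (1-Q)))
      = log (k * r * Q^(k-1)) - log (-log (1-Q)) := by
    rw [hc, log_mul (x := k * r) (y := Q^(k-1)) (by positivity) (by positivity), log_pow]; ring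
  rw [e, sub_pos, log_lt_log_iff hL (by positivity), lt_sub_comm, ← lt_log_iff_exp_lt hp]
  constructor <;> intro h <;> linarith

theorem Qfix_gt (k : ℕ) (hk : 4 ≤ k) (r : ℝ) (Q1 : ℝ) (h0 : 0 < Q1) (h1 : Q1 < 1)
    (h : Q1 < 1 - Real.exp (-((k:ℝ) * r * Q1 ^ (k-1)))) : Q1 < Qfix k r := by
  have hc : ContinuousOn (fun Q : ℝ => 1 - Real.exp (-((k:ℝ) * r * Q ^ (k-1))) - Q)
      (Set.Icc Q1 1) := by fun_prop
  have := intermediate_value_Icc' h1.le hc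
  have hz : (0:ℝ) ∈ Set.Icc (1 - Real.exp (-((k:ℝ) * r * (1:ℝ) ^ (k-1))) - 1)
      (1 - Real.exp (-((k:ℝ) * r * Q1 ^ (k-1))) - Q1) := by
    refine ⟨?_, by linarith⟩
    have := Real.exp_pos (-((k:ℝ) * r * (1:ℝ) ^ (k-1)))
    linarith
  obtain ⟨Q, hQ, hQ0⟩ := this hz
  simp only at hQ0
  have hne : Q1 ≠ Q := by
    rintro rfl
    linarith
  refine lt_of_lt_of_le (lt_of_le_of_ne hQ.1 hne) (le_csSup ⟨1, fun x hx => hx.1.2⟩ ?_)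
  exact ⟨⟨by linarith [hQ.1], hQ.2⟩, by linarith⟩

/-- If `k ≥ 4` and `r_core(k) < r ≤ 1`, then `Q(k,r) > e^(-1/k)`. -/
theorem stmt_5 (k : ℕ) (hk : 4 ≤ k) (r : ℝ) (hr1 : rCore k < r) (hr2 : r ≤ 1) :
    Qfix k r > Real.exp (-1 / (k : ℝ)) := by
  have hk' : (4:ℝ) ≤ k := by exact_mod_cast hk
  have hk0 : (0:ℝ) < k := by linarith
  have hrc : 0 ≤ rCore k := Real.sSup_nonneg (fun x hx => hx.1.1)
  have hr : 0 < r := by linarith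
  obtain ⟨s, hs1, hs2⟩ := exists_between hr1
  have hs : s ∉ {r : ℝ | r ∈ Set.Icc (0:ℝ) 1 ∧
    ∀ Q ∈ Set.Ioo (0:ℝ) 1, Q > 1 - Real.exp (-((k : ℝ) * r * Q ^ (k - 1)))} := by
    intro hmem
    have : s ≤ rCore k := le_csSup ⟨1, fun x hx => hx.1.2⟩ hmem
    linarith
  have hs' : ∃ Q ∈ Set.Ioo (0:ℝ) 1, Q ≤ 1 - Real.exp (-((k : ℝ) * s * Q ^ (k - 1))) := by
    by_contra hcon
    push Not at hcon
    exact hs ⟨⟨by linarith, by linarith⟩, hcon⟩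
  obtain ⟨Q1, ⟨hQ0, hQ1⟩, hQ⟩ := hs'
  have hF : Q1 < 1 - Real.exp (-((k : ℝ) * r * Q1 ^ (k - 1))) := by
    refine lt_of_le_of_lt hQ ?_
    have : Real.exp (-((k : ℝ) * r * Q1 ^ (k - 1))) < Real.exp (-((k : ℝ) * s * Q1 ^ (k - 1))) := by
      rw [Real.exp_lt_exp, neg_lt_neg_iff]
      gcongr
    linarith
  rcases lt_or_ge (Real.exp (-1 / (k:ℝ))) Q1 with hlt | hge
  · exact hlt.trans (Qfix_gt k hk r Q1 hQ0 hQ1 hF)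
  · have hX1 : Real.exp (-1 / (k:ℝ)) < 1 := by
      rw [Real.exp_lt_one_iff]; exact div_neg_of_neg_of_pos (by norm_num) hk0
    have hX0 := Real.exp_pos (-1 / (k:ℝ))
    have hb := L0_bound k hk
    apply Qfix_gt k hk r _ hX0 hX1
    rw [cond_iff k hk r hr _ hX0 hX1]
    rw [cond_iff k hk r hr _ hQ0 hQ1] at hF
    set X := Real.exp (-1 / (k:ℝ))
    have hL0 : 0 < -Real.log (1 - X) := by
      have := Real.log_neg (x := 1 - X) (by linarith) (by linarith)
      linarith
    have hL1 : 0 < -Real.log (1 - Q1) := by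
      have := Real.log_neg (x := 1 - Q1) (by linarith) (by linarith)
      linarith
    have hle : -Real.log (1 - Q1) ≤ -Real.log (1 - X) := by
      rw [neg_le_neg_iff]
      exact Real.log_le_log (by linarith) (by linarith)
    have := psi_mono k hk _ hL0 hb ⟨hL1, hle⟩ ⟨hL0, le_rfl⟩ hle
    simp only at this
    linarith
end

section
/- Let k ≥ 4 be an integer and r a real number with r_core(k) < r ≤ 1. Then μ(k,r) < μ_u(k). -/
/-- `μ(k,r) = exp(-k·r·Q(k,r)^(k-1)) + k·r·Q(k,r)^(k-1)·exp(-k·r·Q(k,r)^(k-1))`. -/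
noncomputable def mu (k : ℕ) (r : ℝ) : ℝ :=
  Real.exp (-((k : ℝ) * r * Qfix k r ^ (k - 1)))
    + (k : ℝ) * r * Qfix k r ^ (k - 1) * Real.exp (-((k : ℝ) * r * Qfix k r ^ (k - 1)))

/-- `μ_u(k) = (1 - e^(-1/k)) - (1 - e^(-1/k))·ln(1 - e^(-1/k))`. -/
noncomputable def muU (k : ℕ) : ℝ :=
  (1 - Real.exp (-1 / (k : ℝ)))
    - (1 - Real.exp (-1 / (k : ℝ))) * Real.log (1 - Real.exp (-1 / (k : ℝ)))

lemma aux_mono (y z : ℝ) (hy : 0 < y) (hyz : y < z) (hz : z < 1) :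
    y - y * Real.log y < z - z * Real.log z := by
  have hz0 : 0 < z := hy.trans hyz
  have h1 : Real.log (z / y) ≤ z / y - 1 := Real.log_le_sub_one_of_pos (by positivity)
  rw [Real.log_div hz0.ne' hy.ne'] at h1
  have h2 : y * (Real.log z - Real.log y) ≤ z - y := by
    have := mul_le_mul_of_nonneg_left h1 hy.le
    have h3 : y * (z / y - 1) = z - y := by field_simp
    linarith
  have h4 : Real.log z < 0 := Real.log_neg hz0 hz
  nlinarith [mul_pos (sub_pos.2 hyz) (neg_pos.2 h4)]

lemma aux_conv (K x : ℝ) (hK : 4 ≤ K) (hx : 0 < x) (hx2 : x ≤ Real.log (K + 1)) :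
    Real.exp x - 1 < (K - 1) * x := by
  set L := Real.log (K + 1) with hL
  have hL1 : 4 / 3 < L := by
    have h1 : Real.log 4 ≤ L := Real.log_le_log (by norm_num) (by linarith)
    have h2 : Real.log 4 = 2 * Real.log 2 := by
      rw [show (4:ℝ) = 2 ^ 2 by norm_num, Real.log_pow]; norm_num
    have := Real.log_two_gt_d9
    linarith
  have hL0 : 0 < L := by linarith
  have heL : Real.exp L = K + 1 := Real.exp_log (by linarith)
  have hc := convexOn_exp.2 (Set.mem_univ (0:ℝ)) (Set.mem_univ L)
    (show 0 ≤ 1 - x / L by rw [sub_nonneg, div_le_one hL0]; exact hx2) (show 0 ≤ x / L by positivity) (by ring)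
  simp only [smul_eq_mul, mul_zero, zero_add, Real.exp_zero, heL] at hc
  rw [div_mul_cancel₀ _ hL0.ne'] at hc
  have h5 : K < (K - 1) * L := by nlinarith
  have h6 : x / L * K < x / L * ((K - 1) * L) :=
    mul_lt_mul_of_pos_left h5 (by positivity)
  have h7 : x / L * ((K - 1) * L) = (K - 1) * x := by field_simp
  nlinarith

lemma aux_ivt (k : ℕ) (r q : ℝ) (hq1 : q < 1)
    (h : q ≤ 1 - Real.exp (-((k : ℝ) * r * q ^ (k - 1)))) :
    ∃ p ∈ Set.Icc q 1, p = 1 - Real.exp (-((k : ℝ) * r * p ^ (k - 1))) := by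
  have hc : ContinuousOn (fun p : ℝ => 1 - Real.exp (-((k : ℝ) * r * p ^ (k - 1))) - p)
      (Set.Icc q 1) := by fun_prop
  have := intermediate_value_Icc' hq1.le hc
  have h0 : (0:ℝ) ∈ Set.Icc (1 - Real.exp (-((k : ℝ) * r * 1 ^ (k - 1))) - 1)
      (1 - Real.exp (-((k : ℝ) * r * q ^ (k - 1))) - q) :=
    ⟨by linarith [Real.exp_pos (-((k : ℝ) * r * 1 ^ (k - 1)))], by linarith⟩
  obtain ⟨p, hp, hp2⟩ := this h0
  exact ⟨p, hp, by simp only at hp2; linarith⟩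

lemma aux_Q (k : ℕ) (hk : 4 ≤ k) (r Q : ℝ) (hQ0 : 0 < Q)
    (hQ : Q = 1 - Real.exp (-((k : ℝ) * r * Q ^ (k - 1))))
    (hmax : ∀ p ∈ Set.Icc (0:ℝ) 1, p = 1 - Real.exp (-((k : ℝ) * r * p ^ (k - 1))) → p ≤ Q) :
    Real.exp (-1 / (k : ℝ)) < Q := by
  by_contra! hle
  have hK : (4:ℝ) ≤ k := by exact_mod_cast hk
  have hK0 : (0:ℝ) < k := by linarith
  set x := (k : ℝ) * r * Q ^ (k - 1) with hx
  have hex : Real.exp (-x) = 1 - Q := by linarith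
  have hQ1 : Q < 1 := by linarith [Real.exp_pos (-x)]
  have hexx : Real.exp x * (1 - Q) = 1 := by rw [← hex, ← Real.exp_add]; simp
  have hx0 : 0 < x := by
    have : Real.exp (-x) < 1 := by linarith
    rw [Real.exp_lt_one_iff] at this; linarith
  have hQk : Q * (k + 1) ≤ k := by
    have h1 : 1 / (k:ℝ) + 1 ≤ Real.exp (1 / (k:ℝ)) := Real.add_one_le_exp _
    have h2 : Real.exp (-1 / (k : ℝ)) * Real.exp (1 / (k:ℝ)) = 1 := by
      rw [← Real.exp_add, ← add_div]; simp
    have h3 : Q * (1 / (k:ℝ) + 1) ≤ 1 := by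
      exact (mul_le_mul hle h1 (by positivity) (Real.exp_pos _).le).trans h2.le
    have h4 : Q * (k + 1) = Q * (1 / (k:ℝ) + 1) * k := by field_simp; ring
    rw [h4]; nlinarith
  have hxL : x ≤ Real.log (k + 1) := by
    rw [Real.le_log_iff_exp_le (by linarith)]
    have h1 : Real.exp x * 1 ≤ Real.exp x * ((1 - Q) * (k + 1)) :=
      mul_le_mul_of_nonneg_left (by linarith) (Real.exp_pos _).le
    nlinarith
  have hkey := aux_conv k x hK hx0 hxL
  have hder : HasDerivAt (fun p : ℝ => 1 - Real.exp (-((k : ℝ) * r * p ^ (k - 1))) - p)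
      (-(Real.exp (-x) * (-((k : ℝ) * r * (((k - 1 : ℕ) : ℝ) * Q ^ (k - 1 - 1))))) - 1) Q := by
    have h := (((hasDerivAt_pow (k - 1) Q).const_mul ((k : ℝ) * r)).neg.exp.const_sub 1).sub
      (hasDerivAt_id Q)
    exact h
  have hpos : 0 < -(Real.exp (-x) * (-((k : ℝ) * r * (((k - 1 : ℕ) : ℝ) * Q ^ (k - 1 - 1))))) - 1 := by
    have hcast : ((k - 1 : ℕ) : ℝ) = k - 1 := by
      rw [Nat.cast_sub (by omega)]; simp
    have hp : Q ^ (k - 1 - 1) * Q = Q ^ (k - 1) := by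
      rw [← pow_succ]; congr 1; omega
    have h1 : (Real.exp x - 1) * (1 - Q) < (k - 1) * x * (1 - Q) :=
      mul_lt_mul_of_pos_right hkey (by linarith)
    have h2 : Q < (k - 1) * x * (1 - Q) := by nlinarith
    have h3 : (-(Real.exp (-x) * (-((k : ℝ) * r * (((k - 1 : ℕ) : ℝ) * Q ^ (k - 1 - 1))))) - 1) * Q
        = (k - 1) * x * (1 - Q) - Q := by
      rw [hcast, hex, hx, ← hp]; ring
    have h4 : 0 < (-(Real.exp (-x) * (-((k : ℝ) * r * (((k - 1 : ℕ) : ℝ) * Q ^ (k - 1 - 1))))) - 1) * Q := by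
      rw [h3]; linarith
    exact pos_of_mul_pos_left h4 hQ0.le
  have hev := (hasDerivWithinAt_iff_tendsto_slope' (s := Set.Ioi Q) (by simp)).1
    hder.hasDerivWithinAt
  have hev2 := hev.eventually (lt_mem_nhds hpos)
  have hev3 : ∀ᶠ p in nhdsWithin Q (Set.Ioi Q), p ∈ Set.Ioo Q 1 := Ioo_mem_nhdsGT hQ1
  obtain ⟨p, hp1, hp2⟩ := (hev2.and hev3).exists
  rw [slope_def_field] at hp1
  have h5 : 0 < p - Q := sub_pos.2 hp2.1
  have h6 := (div_pos_iff_of_pos_right h5).1 hp1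
  simp only [← hx, hex] at h6
  obtain ⟨s, hs, hs2⟩ := aux_ivt k r p hp2.2 (by linarith)
  have := hmax s ⟨by linarith [hs.1, hp2.1], hs.2⟩ hs2
  linarith [hs.1, hp2.1]

/-- If `k ≥ 4` and `r_core(k) < r ≤ 1`, then `μ(k,r) < μ_u(k)`. -/
theorem stmt_6 (k : ℕ) (hk : 4 ≤ k) (r : ℝ) (hr1 : rCore k < r) (hr2 : r ≤ 1) :
    mu k r < muU k := by
  have hbdd : BddAbove {r : ℝ | r ∈ Set.Icc (0:ℝ) 1 ∧
    ∀ Q ∈ Set.Ioo (0:ℝ) 1, Q > 1 - Real.exp (-((k : ℝ) * r * Q ^ (k - 1)))} :=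
    ⟨1, fun r hr => hr.1.2⟩
  have hc0 : 0 ≤ rCore k := Real.sSup_nonneg (fun x hx => hx.1.1)
  have hr0 : 0 < r := lt_of_le_of_lt hc0 hr1
  have hnot : ∃ q ∈ Set.Ioo (0:ℝ) 1, q ≤ 1 - Real.exp (-((k : ℝ) * r * q ^ (k - 1))) := by
    by_contra! h
    exact absurd (le_csSup hbdd ⟨⟨hr0.le, hr2⟩, h⟩) (not_le.2 hr1)
  obtain ⟨q, hq, hq2⟩ := hnot
  obtain ⟨s, hs, hs2⟩ := aux_ivt k r q hq.2 hq2
  set S := {Q : ℝ | Q ∈ Set.Icc (0:ℝ) 1 ∧ Q = 1 - Real.exp (-((k : ℝ) * r * Q ^ (k - 1)))} with hS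
  have hsS : s ∈ S := ⟨⟨hq.1.le.trans hs.1, hs.2⟩, hs2⟩
  have hSb : BddAbove S := ⟨1, fun p hp => hp.1.2⟩
  have hcomp : IsCompact S := by
    have : IsClosed {Q : ℝ | Q = 1 - Real.exp (-((k : ℝ) * r * Q ^ (k - 1)))} :=
      isClosed_eq (by fun_prop) (by fun_prop)
    exact isCompact_Icc.inter_right this
  have hmem : Qfix k r ∈ S := hcomp.sSup_mem ⟨s, hsS⟩
  have hle : ∀ p ∈ S, p ≤ Qfix k r := fun p hp => le_csSup hSb hp
  have hmain := aux_Q k hk r (Qfix k r) (by linarith [hle s hsS, hs.1, hq.1]) hmem.2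
    (fun p hp hp2 => hle p ⟨hp, hp2⟩)
  unfold mu muU
  have hfix := hmem.2
  set x := (k : ℝ) * r * Qfix k r ^ (k - 1) with hx
  have hlt : Real.exp (-x) < 1 - Real.exp (-1 / (k : ℝ)) := by linarith
  have := aux_mono (Real.exp (-x)) _ (Real.exp_pos _) hlt
    (by linarith [Real.exp_pos (-1 / (k : ℝ))])
  rw [Real.log_exp] at this
  linarith
end

section
/- For every integer k ≥ 3, the function r ↦ w_1(k,r) is decreasing on (0,1]: for all real numbers r, r' with 0 < r ≤ r' ≤ 1, one has w_1(k,r') ≤ w_1(k,r). -/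
/-- The lower incomplete gamma function `γ(a,x) = ∫_0^x t^(a-1)·e^(-t) dt`. -/
noncomputable def lowerGamma (a x : ℝ) : ℝ :=
  ∫ t in (0:ℝ)..x, t ^ (a - 1) * Real.exp (-t)

/-- `w_1(k,r) = ((k·r)^(1/(1-k))/(k-1)) · γ(1/(k-1), k·r)`. -/
noncomputable def w1 (k : ℕ) (r : ℝ) : ℝ :=
  (((k : ℝ) * r) ^ (1 / (1 - (k : ℝ))) / ((k : ℝ) - 1)) *
    lowerGamma (1 / ((k : ℝ) - 1)) ((k : ℝ) * r)

theorem aux_lg (a x : ℝ) (hx : 0 < x) :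
    x ^ (-a) * lowerGamma a x = ∫ u in (0:ℝ)..1, u ^ (a - 1) * Real.exp (-(x * u)) := by
  have h := intervalIntegral.mul_integral_comp_mul_left (a := 0) (b := 1)
    (f := fun t : ℝ => t ^ (a - 1) * Real.exp (-t)) x
  rw [mul_zero, mul_one] at h
  unfold lowerGamma
  rw [← h, ← mul_assoc, ← intervalIntegral.integral_const_mul]
  apply intervalIntegral.integral_congr
  intro u hu
  rw [Set.uIcc_of_le zero_le_one] at hu
  have e : x ^ (-a) * x * x ^ (a - 1) = 1 := by
    rw [Real.rpow_sub_one hx.ne', Real.rpow_neg hx.le]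
    have := (Real.rpow_pos_of_pos hx a).ne'
    field_simp
  simp only
  rw [Real.mul_rpow hx.le hu.1]
  linear_combination (u ^ (a - 1) * Real.exp (-(x * u))) * e

/-- For every integer `k ≥ 3`, `r ↦ w_1(k,r)` is decreasing on `(0,1]`:
if `0 < r ≤ r' ≤ 1` then `w_1(k,r') ≤ w_1(k,r)`. -/
theorem stmt_9 (k : ℕ) (hk : 3 ≤ k) (r r' : ℝ) (h0 : 0 < r) (hrr' : r ≤ r') (h1 : r' ≤ 1) :
    w1 k r' ≤ w1 k r := by
  have hk' : (3:ℝ) ≤ k := by exact_mod_cast hk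
  have key : ∀ s : ℝ, 0 < s → w1 k s = (1 / ((k:ℝ) - 1)) *
      ∫ u in (0:ℝ)..1, u ^ (1 / ((k:ℝ) - 1) - 1) * Real.exp (-((k * s) * u)) := by
    intro s hs
    rw [← aux_lg _ _ (by positivity)]
    unfold w1
    have : 1 / (1 - (k:ℝ)) = -(1 / ((k:ℝ) - 1)) := by
      rw [← neg_sub, div_neg]
    rw [this]
    ring
  rw [key r h0, key r' (h0.trans_le hrr')]
  have hp : 0 < 1 / ((k:ℝ) - 1) := by
    apply one_div_pos.2; linarith
  have hi : ∀ s : ℝ, IntervalIntegrable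
      (fun u : ℝ => u ^ (1 / ((k:ℝ) - 1) - 1) * Real.exp (-((k * s) * u)))
      MeasureTheory.volume 0 1 := fun s =>
    (intervalIntegral.intervalIntegrable_rpow' (by linarith)).mul_continuousOn
      (by fun_prop)
  apply mul_le_mul_of_nonneg_left _ hp.le
  apply intervalIntegral.integral_mono_on zero_le_one (hi _) (hi _)
  intro u hu
  have := hu.1
  gcongr
end

section
/- For every integer k ≥ 3, one has w_1*(k) ≤ w_1*(k+1); that is, the sequence k ↦ w_1*(k) is increasing for k ≥ 3. -/
/-- `w_1*(k) = (k^(1/(1-k))/(k-1)) · γ(1/(k-1), k·(k/(k+1))^(k-1))`. -/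
noncomputable def w1star (k : ℕ) : ℝ :=
  ((k : ℝ) ^ (1 / (1 - (k : ℝ))) / ((k : ℝ) - 1)) *
    lowerGamma (1 / ((k : ℝ) - 1)) ((k : ℝ) * ((k : ℝ) / ((k : ℝ) + 1)) ^ (k - 1))

lemma w1star_eq (m : ℕ) (hm : 2 ≤ m) : w1star (m + 1) =
    ∫ u in (0:ℝ)..(((m:ℝ) + 1) / (m + 2)), Real.exp (-(((m:ℝ) + 1) * u ^ m)) := by
  have hm0 : (0:ℝ) < m := by exact_mod_cast (by omega : 0 < m)
  have hK : (0:ℝ) < (m:ℝ) + 1 := by positivity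
  set K : ℝ := (m:ℝ) + 1 with hKdef
  set b : ℝ := K / (m + 2) with hb
  have hb0 : 0 < b := by positivity
  set a : ℝ := 1 / (m:ℝ) with ha
  have ha0 : 0 < a := by positivity
  -- pointwise identity
  have key : ∀ u : ℝ, 0 < u →
      ((K * u ^ m) ^ (a - 1) * Real.exp (-(K * u ^ m))) * (K * (m * u ^ (m - 1)))
        = (K ^ a * m) * Real.exp (-(K * u ^ m)) := by
    intro u hu
    have h1 : (K * u ^ m) ^ (a - 1) = K ^ a * u / (K * u ^ m) := by
      rw [Real.rpow_sub_one (by positivity), Real.mul_rpow hK.le (by positivity)]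
      congr 2
      rw [← Real.rpow_natCast, ← Real.rpow_mul hu.le, ha, mul_one_div_cancel hm0.ne',
        Real.rpow_one]
    have h2 : u ^ m = u ^ (m - 1) * u := by
      rw [← pow_succ]; congr 1; omega
    have h3 : (K ^ a * u / (K * u ^ m)) * (K * (m * u ^ (m - 1))) = K ^ a * m := by
      rw [h2]; field_simp
    rw [h1, mul_right_comm, h3]
  have hsub := intervalIntegral.integral_comp_mul_deriv''' (a := 0) (b := b)
    (f := fun u : ℝ => K * u ^ m) (f' := fun u => K * (m * u ^ (m - 1)))
    (g := fun t : ℝ => t ^ (a - 1) * Real.exp (-t))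
    (by fun_prop)
    (by
      intro x _
      exact ((hasDerivAt_pow m x).const_mul K).hasDerivWithinAt)
    (by
      rintro t ⟨u, hu, rfl⟩
      rw [min_eq_left hb0.le] at hu
      have hu0 : 0 < u := hu.1
      have : (0:ℝ) < K * u ^ m := by positivity
      apply ContinuousAt.continuousWithinAt
      exact (Real.continuousAt_rpow_const _ _ (Or.inl this.ne')).mul (by fun_prop))
    (by
      have hI : IntervalIntegrable (fun t : ℝ => t ^ (a - 1) * Real.exp (-t))
          MeasureTheory.volume 0 (K * b ^ m) :=
        (intervalIntegral.intervalIntegrable_rpow' (by linarith)).mul_continuousOn (by fun_prop)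
      rw [intervalIntegrable_iff_integrableOn_Icc_of_le (by positivity)] at hI
      refine hI.mono_set ?_
      rintro t ⟨u, hu, rfl⟩
      rw [Set.uIcc_of_le hb0.le] at hu
      have := hu.1
      refine ⟨by positivity, ?_⟩
      have := pow_le_pow_left₀ hu.1 hu.2 m
      exact mul_le_mul_of_nonneg_left this hK.le)
    (by
      rw [Set.uIcc_of_le hb0.le, integrableOn_Icc_iff_integrableOn_Ioc]
      have hc : MeasureTheory.IntegrableOn
          (fun u : ℝ => (K ^ a * m) * Real.exp (-(K * u ^ m))) (Set.Ioc 0 b) :=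
        (Continuous.integrableOn_Icc (by fun_prop)).mono_set Set.Ioc_subset_Icc_self
      refine hc.congr_fun ?_ measurableSet_Ioc
      intro u hu
      exact (key u hu.1).symm)
  have hL : (∫ x in (0:ℝ)..b, ((fun t : ℝ => t ^ (a - 1) * Real.exp (-t)) ∘
      fun u : ℝ => K * u ^ m) x * (K * (m * x ^ (m - 1))))
      = (K ^ a * m) * ∫ u in (0:ℝ)..b, Real.exp (-(K * u ^ m)) := by
    rw [← intervalIntegral.integral_const_mul]
    apply intervalIntegral.integral_congr_ae
    refine Filter.Eventually.of_forall ?_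
    intro u hu
    rw [Set.uIoc_of_le hb0.le] at hu
    exact key u hu.1
  rw [hL] at hsub
  have hz : K * (0:ℝ) ^ m = 0 := by rw [zero_pow (by omega), mul_zero]
  have e1 : ((m + 1 : ℕ) : ℝ) = K := by push_cast; rfl
  have e2 : K - 1 = m := by rw [hKdef]; ring
  have e3 : K + 1 = m + 2 := by rw [hKdef]; ring
  have e4 : 1 / (1 - K) = -a := by
    rw [ha, ← e2, ← neg_sub K 1, one_div, one_div, inv_neg]
  unfold w1star lowerGamma
  rw [e1, e2, e3, e4, Nat.add_sub_cancel, ← ha, ← hb]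
  simp only [hz] at hsub
  rw [← hsub, Real.rpow_neg hK.le]
  have : (0:ℝ) < K ^ a := by positivity
  field_simp

/-- The sequence `k ↦ w_1*(k)` is increasing for `k ≥ 3`:
`w_1*(k) ≤ w_1*(k+1)`. -/
theorem stmt_10 (k : ℕ) (hk : 3 ≤ k) : w1star k ≤ w1star (k + 1) := by
  obtain ⟨m, rfl⟩ : ∃ m, k = m + 1 := ⟨k - 1, by omega⟩
  rw [w1star_eq m (by omega), w1star_eq (m + 1) (by omega)]
  push_cast
  have hm0 : (0:ℝ) ≤ m := by positivity
  have hb0 : (0:ℝ) ≤ ((m:ℝ) + 1) / (m + 2) := by positivity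
  have hle : ((m:ℝ) + 1) / (m + 2) ≤ ((m:ℝ) + 1 + 1) / (m + 1 + 2) := by
    rw [div_le_div_iff₀ (by positivity) (by positivity)]; nlinarith
  calc _ ≤ ∫ u in (0:ℝ)..(((m:ℝ) + 1) / (m + 2)),
        Real.exp (-(((m:ℝ) + 1 + 1) * u ^ (m + 1))) := by
        apply intervalIntegral.integral_mono_on hb0
          (Continuous.intervalIntegrable (by fun_prop) _ _)
          (Continuous.intervalIntegrable (by fun_prop) _ _)
        intro u hu
        apply Real.exp_le_exp.2
        have h0 := hu.1
        have h1 := hu.2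
        rw [le_div_iff₀ (by positivity)] at h1
        have h2 : 0 ≤ u ^ m := by positivity
        rw [pow_succ]
        nlinarith
    _ ≤ _ := by
        apply intervalIntegral.integral_mono_interval le_rfl hb0 hle
        · exact Filter.Eventually.of_forall fun u => (Real.exp_pos _).le
        · exact Continuous.intervalIntegrable (by fun_prop) _ _
end

section
/- Let k and k0 be integers with k ≥ k0 ≥ 3, and let r ∈ (0,1] be a real number. Then w_1(k,r) ≥ w_1*(k0). -/
open MeasureTheory Set in
theorem lowerGamma_subst (n : ℕ) (hn : 1 ≤ n) (A c : ℝ) (hA : 0 < A) (hc : 0 < c) :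
    lowerGamma (1 / (n:ℝ)) (A * c ^ n) =
      A ^ (1 / (n:ℝ)) * n * ∫ s in (0:ℝ)..c, Real.exp (-(A * s ^ n)) := by
  have hn0 : (0:ℝ) < n := by exact_mod_cast hn
  have hn' : n ≠ 0 := by omega
  have himg : (fun s : ℝ => A * s ^ n) '' Ioc 0 c = Ioc 0 (A * c ^ n) := by
    ext t
    simp only [mem_image, mem_Ioc]
    constructor
    · rintro ⟨s, ⟨h1, h2⟩, rfl⟩
      exact ⟨by positivity, by gcongr⟩
    · rintro ⟨h1, h2⟩
      have hq : 0 < t / A := by positivity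
      refine ⟨(t / A) ^ ((n:ℝ)⁻¹), ⟨by positivity, ?_⟩, ?_⟩
      · have h3 : t / A ≤ c ^ n := by rw [div_le_iff₀ hA]; linarith
        calc (t / A) ^ ((n:ℝ)⁻¹) ≤ (c ^ n) ^ ((n:ℝ)⁻¹) := by gcongr
          _ = c := Real.pow_rpow_inv_natCast hc.le hn'
      · rw [Real.rpow_inv_natCast_pow hq.le hn']; field_simp
  have hinj : InjOn (fun s : ℝ => A * s ^ n) (Ioc 0 c) := by
    intro x hx y hy hxy
    have h : x ^ n = y ^ n := mul_left_cancel₀ hA.ne' hxy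
    exact (pow_left_inj₀ hx.1.le hy.1.le hn').1 h
  have key := integral_image_eq_integral_abs_deriv_smul (s := Ioc 0 c)
    (f := fun s : ℝ => A * s ^ n) (f' := fun s => A * (n * s ^ (n-1))) measurableSet_Ioc
    (fun x _ => ((hasDerivAt_pow n x).const_mul A).hasDerivWithinAt) hinj
    (fun t => t ^ (1 / (n:ℝ) - 1) * Real.exp (-t))
  rw [himg] at key
  unfold lowerGamma
  rw [intervalIntegral.integral_of_le (by positivity), key,
    intervalIntegral.integral_of_le hc.le, ← integral_const_mul]
  refine setIntegral_congr_fun measurableSet_Ioc ?_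
  intro s hs
  have hs0 := hs.1
  have h1 : s ^ (n - 1) * s = s ^ n := by rw [← pow_succ]; congr 1; omega
  have h2 : (s ^ n) ^ (1 / (n:ℝ)) = s := by
    rw [one_div]; exact Real.pow_rpow_inv_natCast hs0.le hn'
  simp only [smul_eq_mul]
  rw [abs_of_pos (by positivity), Real.mul_rpow hA.le (by positivity),
    Real.rpow_sub hA, Real.rpow_sub (by positivity), Real.rpow_one, Real.rpow_one, h2, ← h1]
  field_simp

theorem pref_eq (k : ℕ) (hk : 3 ≤ k) (A c : ℝ) (hA : 0 < A) (hc : 0 < c) :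
    (A ^ (1 / (1 - (k : ℝ))) / ((k : ℝ) - 1)) * lowerGamma (1 / ((k : ℝ) - 1)) (A * c ^ (k-1))
      = ∫ s in (0:ℝ)..c, Real.exp (-(A * s ^ (k-1))) := by
  have h := lowerGamma_subst (k-1) (by omega) A c hA hc
  have hcast : ((k - 1 : ℕ) : ℝ) = (k:ℝ) - 1 := by
    rw [Nat.cast_sub (by omega)]; simp
  rw [hcast] at h
  have hk1 : (0:ℝ) < (k:ℝ) - 1 := by
    have : (3:ℝ) ≤ k := by exact_mod_cast hk
    linarith
  have e : 1 / (1 - (k:ℝ)) = - (1 / ((k:ℝ) - 1)) := by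
    rw [← neg_sub, one_div, one_div, inv_neg]
  have hp : 0 < A ^ (1 / ((k:ℝ) - 1)) := Real.rpow_pos_of_pos hA _
  rw [h, e, Real.rpow_neg hA.le]
  field_simp

theorem pt_le (k₀ k : ℕ) (h3 : 3 ≤ k₀) (hk : k₀ ≤ k) (s : ℝ) (hs : 0 ≤ s)
    (hs' : s ≤ (k₀:ℝ) / (k₀ + 1)) : (k:ℝ) * s ^ (k-1) ≤ k₀ * s ^ (k₀ - 1) := by
  induction k, hk using Nat.le_induction with
  | base => exact le_rfl
  | succ m hm ih =>
    refine le_trans ?_ ih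
    have hmk : (k₀:ℝ) ≤ m := by exact_mod_cast hm
    rw [le_div_iff₀ (by positivity)] at hs'
    have hk0 : (0:ℝ) ≤ k₀ := by positivity
    have hs1 : s ≤ 1 := by nlinarith
    have h1 : s ^ (m + 1 - 1) = s ^ (m-1) * s := by rw [← pow_succ]; congr 1; omega
    have h2 : ((m:ℝ) + 1) * s ≤ m := by nlinarith
    rw [h1]
    push_cast
    nlinarith [pow_nonneg hs (m-1)]

/-- For integers `k ≥ k₀ ≥ 3` and `r ∈ (0,1]`, `w_1(k,r) ≥ w_1*(k₀)`. -/
theorem stmt_11 (k k₀ : ℕ) (hk₀ : 3 ≤ k₀) (hk : k₀ ≤ k) (r : ℝ) (hr : r ∈ Set.Ioc (0:ℝ) 1) :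
    w1star k₀ ≤ w1 k r := by
  obtain ⟨hr0, hr1⟩ := hr
  have hk0 : (0:ℝ) < k₀ := by exact_mod_cast (by omega : 0 < k₀)
  have hkp : (0:ℝ) < k := by exact_mod_cast (by omega : 0 < k)
  have hc : (0:ℝ) < (k₀:ℝ) / (k₀ + 1) := by positivity
  have hc1 : (k₀:ℝ) / (k₀ + 1) ≤ 1 := by rw [div_le_one (by positivity)]; linarith
  have e1 := pref_eq k₀ hk₀ k₀ _ hk0 hc
  have e2 := pref_eq k (by omega) (k * r) 1 (by positivity) one_pos
  rw [one_pow, mul_one] at e2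
  unfold w1star w1
  rw [e1, e2]
  have hint : ∀ (A : ℝ) (n : ℕ) (a b : ℝ),
      IntervalIntegrable (fun s : ℝ => Real.exp (-(A * s ^ n))) MeasureTheory.volume a b :=
    fun A n a b => Continuous.intervalIntegrable (by fun_prop) a b
  rw [← intervalIntegral.integral_add_adjacent_intervals
    (hint (k * r) (k-1) 0 ((k₀:ℝ) / (k₀ + 1))) (hint _ _ _ 1)]
  have hA : (∫ s in (0:ℝ)..((k₀:ℝ) / (k₀ + 1)), Real.exp (-(k₀ * s ^ (k₀-1)))) ≤
      ∫ s in (0:ℝ)..((k₀:ℝ) / (k₀ + 1)), Real.exp (-(k * r * s ^ (k-1))) := by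
    refine intervalIntegral.integral_mono_on hc.le (hint _ _ _ _) (hint _ _ _ _) ?_
    intro s hs
    have h := pt_le k₀ k hk₀ hk s hs.1 hs.2
    have hp : 0 ≤ (k:ℝ) * s ^ (k-1) := mul_nonneg hkp.le (pow_nonneg hs.1 _)
    apply Real.exp_le_exp.2
    nlinarith
  have hB : 0 ≤ ∫ s in ((k₀:ℝ) / (k₀ + 1))..1, Real.exp (-(k * r * s ^ (k-1))) :=
    intervalIntegral.integral_nonneg hc1 (fun s _ => (Real.exp_pos _).le)
  linarith
end

section
/- Let k ≥ 3 be an integer and r ∈ [0,1], x ∈ [0,1] real numbers. Then the set {S ∈ [0,1] : S = exp(-k·r·((1-x)·(1-S)+x)^(k-1))} is nonempty, its supremum Ŝ(x) is itself a solution of the fixed point equation, the sequence (S_l(x))_{l ≥ 0} converges to Ŝ(x) as l → ∞, and S_l(x) ≥ Ŝ(x) for every l ≥ 0. -/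
/-- The sequence `S_l(x)` defined by `S_0(x) = 1` and
`S_l(x) = exp(-k·r·((1-x)·(1-S_{l-1}(x)) + x)^(k-1))` for `l ≥ 1`. -/
noncomputable def Sseq (k : ℕ) (r x : ℝ) : ℕ → ℝ
  | 0 => 1
  | l + 1 => Real.exp (-((k : ℝ) * r * ((1 - x) * (1 - Sseq k r x l) + x) ^ (k - 1)))

/-- For `k ≥ 3`, `r ∈ [0,1]`, `x ∈ [0,1]`, the set
`{S ∈ [0,1] : S = exp(-k·r·((1-x)(1-S)+x)^(k-1))}` is nonempty, its supremum `Ŝ(x)`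
is itself a fixed point, the sequence `(S_l(x))` converges to `Ŝ(x)`, and
`S_l(x) ≥ Ŝ(x)` for every `l`. -/
theorem stmt_13 (k : ℕ) (hk : 3 ≤ k) (r x : ℝ)
    (hr : r ∈ Set.Icc (0:ℝ) 1) (hx : x ∈ Set.Icc (0:ℝ) 1)
    (F : Set ℝ)
    (hF : F = {S : ℝ | S ∈ Set.Icc (0:ℝ) 1 ∧
      S = Real.exp (-((k : ℝ) * r * ((1 - x) * (1 - S) + x) ^ (k - 1)))}) :
    F.Nonempty ∧ sSup F ∈ F ∧
    Filter.Tendsto (Sseq k r x) Filter.atTop (nhds (sSup F)) ∧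
    (∀ l : ℕ, sSup F ≤ Sseq k r x l) := by
  obtain ⟨hr0, hr1⟩ := hr
  obtain ⟨hx0, hx1⟩ := hx
  set f : ℝ → ℝ := fun S => Real.exp (-((k : ℝ) * r * ((1 - x) * (1 - S) + x) ^ (k - 1))) with hf
  have hkr : 0 ≤ (k : ℝ) * r := by positivity
  have hmono : ∀ a b : ℝ, a ≤ b → b ≤ 1 → f a ≤ f b := by
    intro a b hab hb
    have h1 : 0 ≤ (1 - x) * (1 - b) := mul_nonneg (by linarith) (by linarith)
    have h2 : (1 - x) * (1 - b) ≤ (1 - x) * (1 - a) :=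
      mul_le_mul_of_nonneg_left (by linarith) (by linarith)
    have h3 : ((1 - x) * (1 - b) + x) ^ (k - 1) ≤ ((1 - x) * (1 - a) + x) ^ (k - 1) :=
      pow_le_pow_left₀ (by linarith) (by linarith) _
    exact Real.exp_le_exp.mpr (neg_le_neg (mul_le_mul_of_nonneg_left h3 hkr))
  have hle1 : ∀ a : ℝ, a ≤ 1 → f a ≤ 1 := by
    intro a ha
    have h1 : 0 ≤ (1 - x) * (1 - a) := mul_nonneg (by linarith) (by linarith)
    have h3 : 0 ≤ ((1 - x) * (1 - a) + x) ^ (k - 1) := pow_nonneg (by linarith) _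
    exact Real.exp_le_one_iff.mpr (neg_nonpos.mpr (mul_nonneg hkr h3))
  have hpos : ∀ a : ℝ, 0 ≤ f a := fun a => (Real.exp_pos _).le
  have hcont : Continuous f := by fun_prop
  have hsucc : ∀ l, Sseq k r x (l + 1) = f (Sseq k r x l) := fun l => by rw [Sseq]
  have hzero : Sseq k r x 0 = 1 := by rw [Sseq]
  have hs1 : ∀ l, Sseq k r x l ≤ 1 := by
    intro l
    induction l with
    | zero => exact hzero.le
    | succ n ih => rw [hsucc]; exact hle1 _ ih
  have hs0 : ∀ l, 0 ≤ Sseq k r x l := by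
    intro l
    cases l with
    | zero => rw [hzero]; exact zero_le_one
    | succ n => rw [hsucc]; exact hpos _
  have hanti : Antitone (Sseq k r x) := by
    apply antitone_nat_of_succ_le
    intro l
    induction l with
    | zero => rw [hzero]; exact hs1 _
    | succ n ih => rw [hsucc (n + 1)]; nth_rewrite 2 [hsucc n]; exact hmono _ _ ih (hs1 n)
  have hbdd : BddBelow (Set.range (Sseq k r x)) := ⟨0, by rintro _ ⟨l, rfl⟩; exact hs0 l⟩
  have hlim := tendsto_atTop_ciInf hanti hbdd
  set L := ⨅ l, Sseq k r x l with hL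
  have hLf : L = f L := by
    have h1 := (hcont.tendsto L).comp hlim
    have h2 := hlim.comp (Filter.tendsto_add_atTop_nat 1)
    refine tendsto_nhds_unique h2 (h1.congr fun l => ?_)
    exact (hsucc l).symm
  have hLle : ∀ l, L ≤ Sseq k r x l := fun l => ciInf_le hbdd l
  have hLF : L ∈ F := by
    rw [hF]
    exact ⟨⟨le_ciInf hs0, (hLle 0).trans (hs1 0)⟩, hLf⟩
  have hgr : IsGreatest F L := by
    refine ⟨hLF, ?_⟩
    intro S hS
    rw [hF] at hS
    obtain ⟨⟨_, hS1⟩, hSf⟩ := hS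
    have hSf' : S = f S := hSf
    apply le_ciInf
    intro l
    induction l with
    | zero => rw [hzero]; exact hS1
    | succ n ih => rw [hsucc, hSf']; exact hmono _ _ ih (hs1 n)
  rw [hgr.csSup_eq]
  exact ⟨⟨L, hLF⟩, hLF, hlim, hLle⟩
end

section
/- Let a < b be real numbers and f : ℝ → ℝ a function that is continuous on [a,b] and twice differentiable on (a,b), and suppose f is differentiable at b with f'(b) ≥ 0. Suppose there exists c ∈ (a,b) such that f''(x) > 0 for all x ∈ (a,c) and f''(x) < 0 for all x ∈ (c,b). Then for every x ∈ [a,b], f(x) ≤ max(f(a), f(b)). -/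
/-- Let `a < b`, and let `f` be continuous on `[a,b]`, twice
differentiable on `(a,b)` (with first and second derivatives `f'` and `f''`),
differentiable at `b` with `f'(b) ≥ 0`. If there is `c ∈ (a,b)` with `f'' > 0` on `(a,c)`
and `f'' < 0` on `(c,b)`, then `f(x) ≤ max (f a) (f b)` for all `x ∈ [a,b]`. -/
theorem stmt_16 (a b : ℝ) (hab : a < b) (f f' f'' : ℝ → ℝ)
    (hcont : ContinuousOn f (Set.Icc a b))
    (hderiv1 : ∀ x ∈ Set.Ioo a b, HasDerivAt f (f' x) x)
    (hderiv2 : ∀ x ∈ Set.Ioo a b, HasDerivAt f' (f'' x) x)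
    (hfb : HasDerivAt f (f' b) b) (hf'b : 0 ≤ f' b)
    (c : ℝ) (hc : c ∈ Set.Ioo a b)
    (hpos : ∀ x ∈ Set.Ioo a c, 0 < f'' x)
    (hneg : ∀ x ∈ Set.Ioo c b, f'' x < 0) :
    ∀ x ∈ Set.Icc a b, f x ≤ max (f a) (f b) := by
  obtain ⟨hac, hcb⟩ := hc
  have hd2 : ∀ x ∈ Set.Ioo a b, deriv^[2] f x = f'' x := by
    intro x hx
    have h : deriv f =ᶠ[nhds x] f' := by
      filter_upwards [isOpen_Ioo.mem_nhds hx] with y hy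
      exact (hderiv1 y hy).deriv
    show deriv (deriv f) x = f'' x
    rw [h.deriv_eq]
    exact (hderiv2 x hx).deriv
  have hconv : StrictConvexOn ℝ (Set.Icc a c) f := by
    apply strictConvexOn_of_deriv2_pos (convex_Icc a c)
      (hcont.mono (Set.Icc_subset_Icc le_rfl hcb.le))
    intro x hx
    rw [interior_Icc] at hx
    rw [hd2 x ⟨hx.1, hx.2.trans hcb⟩]
    exact hpos x hx
  have hconc : StrictConcaveOn ℝ (Set.Icc c b) f := by
    apply strictConcaveOn_of_deriv2_neg (convex_Icc c b)
      (hcont.mono (Set.Icc_subset_Icc hac.le le_rfl))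
    intro x hx
    rw [interior_Icc] at hx
    rw [hd2 x ⟨hac.trans hx.1, hx.2⟩]
    exact hneg x hx
  have hR : ∀ x ∈ Set.Icc c b, f x ≤ f b := by
    intro x hx
    rcases hx.2.eq_or_lt with h | h
    · rw [h]
    · have h1 := hconc.concaveOn.le_slope_of_hasDerivAt hx (Set.right_mem_Icc.2 hcb.le) h hfb
      rw [slope_def_field] at h1
      have h2 := hf'b.trans h1
      rw [le_div_iff₀ (sub_pos.2 h)] at h2
      linarith
  intro x hx
  rcases le_total x c with h | h
  · have h1 := hconv.convexOn.le_max_of_mem_Icc (Set.left_mem_Icc.2 hac.le)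
      (Set.right_mem_Icc.2 hac.le) ⟨hx.1, h⟩
    exact h1.trans (max_le_max le_rfl (hR c (Set.left_mem_Icc.2 hcb.le)))
  · exact (hR x ⟨h, hx.2⟩).trans (le_max_right _ _)
end

section
/- One has 2·μ_u(9) < w_1*(9); explicitly, 2·[(1 - e^(-1/9)) - (1 - e^(-1/9))·ln(1 - e^(-1/9))] < (9^(-1/8)/8) · ∫_0^(9·(9/10)^8) t^(-7/8)·e^(-t) dt. -/
lemma aux_P (t : ℝ) (ht : 0 ≤ t) :
    ∑ n ∈ Finset.range 8, (-1 : ℝ) ^ n / (n.factorial : ℝ) * t ^ n ≤ Real.exp (-t) := by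
  let P : ℝ → ℝ := fun t => 1 - t + t^2/2 - t^3/6 + t^4/24 - t^5/120 + t^6/720 - t^7/5040
  have hd : ∀ x : ℝ, HasDerivAt (fun t => P t * Real.exp t) (-(x^7/5040) * Real.exp x) x := by
    intro x
    have h1 : HasDerivAt P (0 - 1 + (2 * x)/2 - (3 * x^2)/6 + (4 * x^3)/24 - (5 * x^4)/120
        + (6 * x^5)/720 - (7 * x^6)/5040) x := by
      have hp : ∀ n : ℕ, HasDerivAt (fun t : ℝ => t ^ n) (n * x ^ (n-1)) x :=
        fun n => hasDerivAt_pow n x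
      have h2 := hp 2
      have h3 := hp 3
      have h4 := hp 4
      have h5 := hp 5
      have h6 := hp 6
      have h7 := hp 7
      norm_num at h2 h3 h4 h5 h6 h7
      exact ((((((((hasDerivAt_const x (1:ℝ)).sub (hasDerivAt_id x)).add (h2.div_const 2)).sub
        (h3.div_const 6)).add (h4.div_const 24)).sub (h5.div_const 120)).add
        (h6.div_const 720)).sub (h7.div_const 5040))
    have := h1.mul (Real.hasDerivAt_exp x)
    exact this.congr_deriv (by simp only [P]; ring)
  have hanti : AntitoneOn (fun t => P t * Real.exp t) (Set.Ici 0) := by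
    apply antitoneOn_of_deriv_nonpos (convex_Ici 0)
    · exact fun x _ => (hd x).continuousAt.continuousWithinAt
    · exact fun x _ => (hd x).differentiableAt.differentiableWithinAt
    · intro x hx
      rw [interior_Ici] at hx
      rw [(hd x).deriv]
      have : 0 < x := hx
      have : 0 ≤ (x^7/5040) * Real.exp x := by positivity
      linarith
  have h := hanti (Set.mem_Ici.2 le_rfl) (Set.mem_Ici.2 ht) ht
  have h' : P t * Real.exp t ≤ 1 := by simpa [P] using h
  have e : ∑ n ∈ Finset.range 8, (-1 : ℝ) ^ n / (n.factorial : ℝ) * t ^ n = P t := by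
    simp only [Finset.sum_range_succ, Finset.sum_range_zero, Nat.factorial, P]
    norm_num
    ring
  rw [e, Real.exp_neg, ← one_div, le_div_iff₀ (Real.exp_pos t)]
  exact h'

lemma aux_int (T : ℝ) (hT : 0 < T) :
    T ^ (1/8 : ℝ) * ∑ n ∈ Finset.range 8, (-1 : ℝ) ^ n / (n.factorial : ℝ) * (T ^ n / (n + 1/8))
      ≤ ∫ t in (0:ℝ)..T, t ^ (-(7 / 8) : ℝ) * Real.exp (-t) := by
  have hi : ∀ n : ℕ, IntervalIntegrable (fun t : ℝ => (-1 : ℝ) ^ n / (n.factorial : ℝ) *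
      t ^ ((n:ℝ) + -(7/8))) MeasureTheory.volume 0 T := by
    intro n
    apply IntervalIntegrable.const_mul
    apply intervalIntegral.intervalIntegrable_rpow'
    have : (0:ℝ) ≤ n := n.cast_nonneg
    linarith
  have hs : ∫ t in (0:ℝ)..T, ∑ n ∈ Finset.range 8, ((-1 : ℝ) ^ n / (n.factorial : ℝ) *
      t ^ ((n:ℝ) + -(7/8))) = T ^ (1/8 : ℝ) * ∑ n ∈ Finset.range 8,
        (-1 : ℝ) ^ n / (n.factorial : ℝ) * (T ^ n / (n + 1/8)) := by
    rw [intervalIntegral.integral_finsetSum (fun n _ => hi n), Finset.mul_sum]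
    apply Finset.sum_congr rfl
    intro n _
    have hn : (0:ℝ) ≤ n := n.cast_nonneg
    rw [intervalIntegral.integral_const_mul, integral_rpow (Or.inl (by linarith))]
    have e : (n:ℝ) + -(7/8) + 1 = n + 1/8 := by ring
    rw [e, Real.zero_rpow (by positivity), Real.rpow_add hT, Real.rpow_natCast]
    ring
  rw [← hs]
  apply intervalIntegral.integral_mono_on hT.le
  · have := IntervalIntegrable.sum (Finset.range 8) (fun n _ => hi n)
    rw [Finset.sum_fn] at this
    exact this
  · apply IntervalIntegrable.mul_continuousOn
    · exact intervalIntegral.intervalIntegrable_rpow' (by norm_num)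
    · fun_prop
  · intro t ht
    have h0 : 0 ≤ t := ht.1
    refine le_trans (le_of_eq ?_) (mul_le_mul_of_nonneg_left (aux_P t h0)
      (Real.rpow_nonneg h0 _))
    rw [Finset.mul_sum]
    apply Finset.sum_congr rfl
    intro n _
    rcases h0.eq_or_lt with h | h
    · subst h
      rcases Nat.eq_zero_or_pos n with h | h
      · subst h; simp
      · have h1 : (1:ℝ) ≤ n := by exact_mod_cast h
        rw [Real.zero_rpow (by linarith), Real.zero_rpow (by norm_num)]
        simp
    · rw [Real.rpow_add h, Real.rpow_natCast]
      ring

lemma aux_lhs : 2 * ((1 - Real.exp (-1 / 9)) -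
        (1 - Real.exp (-1 / 9)) * Real.log (1 - Real.exp (-1 / 9))) < 0.69 := by
  have h1 : 1 - Real.exp (-1/9) ≤ 0.1052 := by
    have := aux_P (1/9) (by norm_num)
    rw [show -(1/9:ℝ) = -1/9 by norm_num] at this
    simp only [Finset.sum_range_succ, Finset.sum_range_zero, Nat.factorial] at this
    norm_num at this ⊢
    linarith
  have h2 : 0.1049 ≤ 1 - Real.exp (-1/9) := by
    have h := Real.quadratic_le_exp_of_nonneg (x := 1/9) (by norm_num)
    have e : Real.exp (-1/9) * Real.exp (1/9) = 1 := by
      rw [← Real.exp_add]; norm_num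
    have := Real.exp_pos (-1/9)
    norm_num at h ⊢
    nlinarith
  have h3 : -2.26 ≤ Real.log (1 - Real.exp (-1/9)) := by
    rw [Real.le_log_iff_exp_le (by linarith)]
    refine le_trans ?_ h2
    have h := Real.quadratic_le_exp_of_nonneg (x := 0.26) (by norm_num)
    have h4 := Real.exp_one_gt_d9
    have e : Real.exp (-2.26) * (Real.exp 1 * Real.exp 1 * Real.exp 0.26) = 1 := by
      rw [← Real.exp_add, ← Real.exp_add, ← Real.exp_add]; norm_num
    have h5 : (2.718 * 2.718 * 1.2938 : ℝ) ≤ Real.exp 1 * Real.exp 1 * Real.exp 0.26 := by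
      gcongr
      · linarith
      · linarith
      · norm_num at h ⊢; linarith
    have h6 := Real.exp_pos (-2.26)
    have h7 := mul_le_mul_of_nonneg_left h5 h6.le
    rw [e] at h7
    norm_num at h7 ⊢
    linarith
  generalize Real.log (1 - Real.exp (-1/9)) = L at *
  generalize 1 - Real.exp (-1/9) = x at *
  norm_num at *
  nlinarith


/-- `2·μ_u(9) < w_1*(9)`; explicitly,
`2·[(1 - e^(-1/9)) - (1 - e^(-1/9))·ln(1 - e^(-1/9))]
  < (9^(-1/8)/8) · ∫_0^(9·(9/10)^8) t^(-7/8)·e^(-t) dt`. -/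
theorem stmt_17 :
    2 * ((1 - Real.exp (-1 / 9)) -
        (1 - Real.exp (-1 / 9)) * Real.log (1 - Real.exp (-1 / 9)))
      < ((9 : ℝ) ^ (-(1 / 8) : ℝ) / 8) *
        ∫ t in (0:ℝ)..(9 * (9 / 10 : ℝ) ^ 8), t ^ (-(7 / 8) : ℝ) * Real.exp (-t) := by
  refine aux_lhs.trans ?_
  have h := aux_int (9 * (9 / 10 : ℝ) ^ 8) (by norm_num)
  have hp : (0:ℝ) < (9 : ℝ) ^ (-(1 / 8) : ℝ) := by positivity
  refine lt_of_lt_of_le ?_ (mul_le_mul_of_nonneg_left h (by positivity))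
  have e : (9 * (9 / 10 : ℝ) ^ 8) ^ (1/8 : ℝ) = 9 ^ (1/8 : ℝ) * (9/10) := by
    rw [Real.mul_rpow (by norm_num) (by norm_num), ← Real.rpow_natCast, ← Real.rpow_mul (by norm_num)]
    norm_num
  have e2 : (9 : ℝ) ^ (-(1 / 8) : ℝ) * 9 ^ (1/8 : ℝ) = 1 := by
    rw [← Real.rpow_add (by norm_num)]; norm_num
  rw [e]
  have e3 : ∀ S : ℝ, (9 : ℝ) ^ (-(1 / 8) : ℝ) / 8 * (9 ^ (1/8 : ℝ) * (9/10) * S) = 9/80 * S := by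
    intro S
    linear_combination (9/80 * S) * e2
  rw [e3]
  simp only [Finset.sum_range_succ, Finset.sum_range_zero, Nat.factorial]
  norm_num
end
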